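/- Let P ⊂ ℝ² be a lattice polygon with P ⊂ [0,∞)² that is not contained in any line and is not a lattice translate of Δ. Assume that the face P^↓ is contained in the line {y=0} and the face P^← is contained in the line {x=0}. Then for a generic polynomial f ∈ ℂ^{P∩ℤ²}, there exist no a, b ∈ ℂ∖{0} such that the affine line L = {(x,y) ∈ ℂ² : ax + by + 1 = 0} has intersection multiplicity ≥ 2 with {f=0} both at the point (−1/a, 0) and at the point (0, −1/b). -/

import Mathlib

open scoped Pointwise
open MvPolynomial

noncomputable section

/-- The torus `(ℂ ∖ {0})²`. -/
def Torus : Set (ℂ × ℂ) := {p | p.1 ≠ 0 ∧ p.2 ≠ 0}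

/-- Evaluation of a bivariate polynomial at a point of `ℂ²`. -/
def evalP (f : MvPolynomial (Fin 2) ℂ) (p : ℂ × ℂ) : ℂ :=
  MvPolynomial.eval (fun i => if i = 0 then p.1 else p.2) f

/-- The affine line through `p` with direction `w`, as a subset of `ℂ²`. -/
def lineThrough (p w : ℂ × ℂ) : Set (ℂ × ℂ) :=
  {q | ∃ t : ℂ, q = (p.1 + t * w.1, p.2 + t * w.2)}

/-- The univariate polynomial `t ↦ f (p + t • w)`. -/
def lineRestrict (f : MvPolynomial (Fin 2) ℂ) (p w : ℂ × ℂ) : Polynomial ℂ :=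
  MvPolynomial.aeval
    (fun i => if i = 0 then Polynomial.C p.1 + Polynomial.C w.1 * Polynomial.X
              else Polynomial.C p.2 + Polynomial.C w.2 * Polynomial.X) f

/-- Intersection multiplicity at `p` of the curve `{f = 0}` and the line through `p`
with direction `w` (as `ℕ∞`; it is `⊤` if the line lies inside the curve). -/
def interMult (f : MvPolynomial (Fin 2) ℂ) (p w : ℂ × ℂ) : ℕ∞ :=
  if lineRestrict f p w = 0 then ⊤
  else (Polynomial.rootMultiplicity 0 (lineRestrict f p w) : ℕ∞)

/-- The point of `ℝ²` corresponding to a lattice point. -/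
def rpt (k : ℤ × ℤ) : ℝ × ℝ := ((k.1 : ℝ), (k.2 : ℝ))

/-- The support of `f` is contained in `S ⊆ ℤ²`. -/
def SuppIn (f : MvPolynomial (Fin 2) ℂ) (S : Set (ℤ × ℤ)) : Prop :=
  ∀ m ∈ f.support, ((m 0 : ℤ), (m 1 : ℤ)) ∈ S

/-- The coefficient of `f` at the exponent `k ∈ ℤ²`. -/
def coeffAt (f : MvPolynomial (Fin 2) ℂ) (k : ℤ × ℤ) : ℂ :=
  if 0 ≤ k.1 ∧ 0 ≤ k.2 then
    f.coeff (Finsupp.single (0 : Fin 2) k.1.toNat + Finsupp.single (1 : Fin 2) k.2.toNat)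
  else 0

/-- A property `Q` holds for a generic polynomial supported in `S`: there is a nonzero
polynomial `D` in variables indexed by `S` such that `Q f` holds for every `f` with
support in `S` whose coefficient tuple is not annihilated by `D`. -/
def GenericOn (S : Set (ℤ × ℤ)) (Q : MvPolynomial (Fin 2) ℂ → Prop) : Prop :=
  ∃ D : MvPolynomial S ℂ, D ≠ 0 ∧
    ∀ f : MvPolynomial (Fin 2) ℂ, SuppIn f S →
      MvPolynomial.eval (fun k => coeffAt f k.1) D ≠ 0 → Q f

/-- `P` is a lattice polygon: the convex hull of finitely many lattice points. -/
def IsLatticePolygon (P : Set (ℝ × ℝ)) : Prop :=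
  ∃ V : Finset (ℤ × ℤ), V.Nonempty ∧ P = convexHull ℝ (rpt '' (V : Set (ℤ × ℤ)))

/-- The standard triangle `Δ = conv {(0,0), (1,0), (0,1)}`. -/
def stdTriangle : Set (ℝ × ℝ) := convexHull ℝ {(0, 0), (1, 0), (0, 1)}

/-- The lattice points of a subset of `ℝ²`. -/
def latticePts (P : Set (ℝ × ℝ)) : Set (ℤ × ℤ) := {k | rpt k ∈ P}

/-- The support set (face) of `P` in the direction of the covector `γ`. -/
def face (P : Set (ℝ × ℝ)) (γ : ℤ × ℤ) : Set (ℝ × ℝ) :=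
  {p ∈ P | ∀ q ∈ P, (γ.1 : ℝ) * q.1 + (γ.2 : ℝ) * q.2 ≤ (γ.1 : ℝ) * p.1 + (γ.2 : ℝ) * p.2}

/-- The lattice length of the face of `P` in direction `γ`. -/
def lenFace (P : Set (ℝ × ℝ)) (γ : ℤ × ℤ) : ℕ := (latticePts (face P γ)).ncard - 1

/-- The Euclidean area of a subset of `ℝ²`. -/
def areaOf (P : Set (ℝ × ℝ)) : ℝ := (MeasureTheory.volume P).toReal

/-- The set of inflection points of `{f = 0}` in the torus. -/
def inflPts (f : MvPolynomial (Fin 2) ℂ) : Set (ℂ × ℂ) :=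
  {p | p ∈ Torus ∧ evalP f p = 0 ∧ ∃ w : ℂ × ℂ, w ≠ 0 ∧ 3 ≤ interMult f p w}

/-- The set of lines (as subsets of `ℂ²`) tangent to `{f = 0}` at two distinct
points of the torus. -/
def bitangentLines (f : MvPolynomial (Fin 2) ℂ) : Set (Set (ℂ × ℂ)) :=
  {l | ∃ p w q₁ q₂ : ℂ × ℂ, w ≠ 0 ∧ l = lineThrough p w ∧
    q₁ ∈ lineThrough p w ∩ Torus ∧ q₂ ∈ lineThrough p w ∩ Torus ∧ q₁ ≠ q₂ ∧
    2 ≤ interMult f q₁ w ∧ 2 ≤ interMult f q₂ w}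

/-- `P` contains a lattice translate of `5Δ`. -/
def Contains5Delta (P : Set (ℝ × ℝ)) : Prop :=
  ∃ t : ℤ × ℤ, rpt t +ᵥ ((5 : ℝ) • stdTriangle) ⊆ P

/-- A polynomial map from an affine space of smaller dimension is not dominant. -/
theorem exists_ne_zero_aeval_eq_zero {σ τ : Type} [Fintype σ] [Fintype τ]
    (h : Fintype.card τ < Fintype.card σ) (g : σ → MvPolynomial τ ℂ) :
    ∃ D : MvPolynomial σ ℂ, D ≠ 0 ∧ aeval g D = 0 := by
  by_contra! hD
  have hg : AlgebraicIndependent ℂ g := by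
    rw [algebraicIndependent_iff]
    exact fun D h0 => by_contra fun hne => hD D hne h0
  have h1 := hg.lift_cardinalMk_le_trdeg
  rw [MvPolynomial.trdeg_of_isDomain] at h1
  simp only [Cardinal.mk_fintype, Cardinal.lift_natCast, Nat.cast_le] at h1
  omega

/-- The four linear conditions, normalized to the point `(1, 1)` of the torus, evaluated at the
monomial with exponent `k`: vanishing on each axis, and the tangency condition on each axis. -/
def tangencyVec (k : ℤ × ℤ) : Fin 4 → ℂ :=
  ![if k.2 = 0 then 1 else 0, if k.1 = 0 then 1 else 0,
    if k.2 = 0 then (k.1 : ℂ) else if k.2 = 1 then -1 else 0,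
    if k.1 = 0 then (k.2 : ℂ) else if k.1 = 1 then -1 else 0]

/-- The torus translates of a subspace of codimension greater than two do not fill the space. -/
theorem exists_ne_zero_eval_torus_translate {S : Set (ℤ × ℤ)} [Fintype S]
    (W : Submodule ℂ (S → ℂ)) (hW : Module.finrank ℂ W + 2 < Fintype.card S) :
    ∃ D : MvPolynomial S ℂ, D ≠ 0 ∧ ∀ d ∈ W, ∀ U V : ℂ,
      MvPolynomial.eval (fun k : S => d k * U ^ k.1.1.toNat * V ^ k.1.2.toNat) D = 0 := by
  let B := Module.finBasis ℂ W
  let g : S → MvPolynomial (Fin (Module.finrank ℂ W) ⊕ Fin 2) ℂ := fun k =>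
    (∑ i, C ((B i : S → ℂ) k) * X (Sum.inl i)) * X (Sum.inr 0) ^ k.1.1.toNat *
      X (Sum.inr 1) ^ k.1.2.toNat
  obtain ⟨D, hD, h0⟩ := exists_ne_zero_aeval_eq_zero (by simpa using hW) g
  refine ⟨D, hD, fun d hd U V => ?_⟩
  have h1 := congrArg (MvPolynomial.eval (Sum.elim (fun i => B.repr ⟨d, hd⟩ i) ![U, V])) h0
  rw [map_zero, aeval_def, ← coe_eval₂Hom, ← RingHom.comp_apply, comp_eval₂Hom] at h1
  have hsum : ∀ k, d k = ∑ i, (B i : S → ℂ) k * B.repr ⟨d, hd⟩ i := by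
    intro k
    have h2 := congrArg (fun w : W => (w : S → ℂ) k) (B.sum_repr ⟨d, hd⟩)
    simp only [Submodule.coe_sum, Submodule.coe_smul, Finset.sum_apply, Pi.smul_apply,
      smul_eq_mul] at h2
    simp only [← h2, mul_comm]
  rw [← h1]
  simp only [coe_eval₂Hom, g, eval]
  congr 1
  · ext x; simp
  · ext k
    simp [hsum]

/-- A polynomial is the sum of its monomials over any finite set containing its support. -/
theorem eq_sum_monomial_coeffAt {S : Set (ℤ × ℤ)} [Fintype S] (hS : ∀ k ∈ S, 0 ≤ k.1 ∧ 0 ≤ k.2)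
    {f : MvPolynomial (Fin 2) ℂ} (hf : SuppIn f S) :
    f = ∑ k : S, C (coeffAt f k) * (X 0 ^ k.1.1.toNat * X 1 ^ k.1.2.toNat) := by
  have hmon : ∀ k : S, C (coeffAt f k) * (X 0 ^ k.1.1.toNat * X 1 ^ k.1.2.toNat) =
      monomial (Finsupp.single (0 : Fin 2) k.1.1.toNat + Finsupp.single 1 k.1.2.toNat)
        (coeffAt f k) := by
    intro k
    rw [X_pow_eq_monomial, X_pow_eq_monomial, monomial_mul, C_mul_monomial]
    simp
  simp only [hmon]
  ext m
  rw [coeff_sum]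
  simp only [coeff_monomial]
  have key : ∀ k : S, Finsupp.single (0 : Fin 2) k.1.1.toNat + Finsupp.single 1 k.1.2.toNat = m ↔
      k.1 = ((m 0 : ℤ), (m 1 : ℤ)) := by
    intro k
    have := hS k k.2
    rw [Finsupp.ext_iff, Fin.forall_fin_two, Prod.ext_iff]
    simp
    omega
  simp only [key]
  by_cases hm : ((m 0 : ℤ), (m 1 : ℤ)) ∈ S
  · rw [Finset.sum_eq_single ⟨_, hm⟩]
    · have : Finsupp.single (0 : Fin 2) (m 0) + Finsupp.single 1 (m 1) = m := by
        ext i; fin_cases i <;> simp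
      simp [coeffAt, this]
    · intro k _ hk
      rw [if_neg fun h => hk (Subtype.ext h)]
    · simp
  · rw [Finset.sum_eq_zero, ← notMem_support_iff]
    · exact fun h => hm (hf m h)
    · intro k _
      rw [if_neg fun h => hm (by rw [← h]; exact k.2)]

theorem coeff_lineRestrict_eq_zero {f : MvPolynomial (Fin 2) ℂ} {p w : ℂ × ℂ}
    (h : 2 ≤ interMult f p w) {n : ℕ} (hn : n < 2) : (lineRestrict f p w).coeff n = 0 := by
  unfold interMult at h
  split_ifs at h with h0
  · simp [h0]
  · have h2 : 2 ≤ Polynomial.rootMultiplicity 0 (lineRestrict f p w) := by exact_mod_cast h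
    rw [Polynomial.le_rootMultiplicity_iff h0, map_zero, sub_zero, Polynomial.X_pow_dvd_iff] at h2
    exact h2 n hn

theorem lineRestrict_eq_sum {S : Set (ℤ × ℤ)} [Fintype S] (hS : ∀ k ∈ S, 0 ≤ k.1 ∧ 0 ≤ k.2)
    {f : MvPolynomial (Fin 2) ℂ} (hf : SuppIn f S) (p w : ℂ × ℂ) :
    lineRestrict f p w = ∑ k : S, Polynomial.C (coeffAt f k) *
      ((Polynomial.C p.1 + Polynomial.C w.1 * Polynomial.X) ^ k.1.1.toNat *
        (Polynomial.C p.2 + Polynomial.C w.2 * Polynomial.X) ^ k.1.2.toNat) := by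
  conv_lhs => rw [eq_sum_monomial_coeffAt hS hf]
  simp [lineRestrict, map_sum]

theorem coeff_one_pow_linear (c e : ℂ) (n : ℕ) :
    ((Polynomial.C c + Polynomial.C e * Polynomial.X) ^ n).coeff 1 = n * c ^ (n - 1) * e := by
  have h := Polynomial.coeff_derivative ((Polynomial.C c + Polynomial.C e * Polynomial.X) ^ n) 0
  simpa [Polynomial.derivative_pow, Polynomial.coeff_zero_eq_eval_zero] using h.symm

theorem tangency_term (u v e g : ℂ) (he : v * e = 1) (hg : u * g = -1) (i j : ℕ) :
    u * v * (i * u ^ (i - 1) * e * 0 ^ j + u ^ i * (j * 0 ^ (j - 1) * g)) =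
      u ^ i * v ^ j * if j = 0 then (i : ℂ) else if j = 1 then -1 else 0 := by
  rcases j with _ | _ | j
  · rcases i with _ | i
    · simp
    · simp only [Nat.add_sub_cancel, pow_zero, pow_succ]
      push_cast
      simp
      linear_combination (i + 1) * u ^ i * u * he
  · simp
    linear_combination v * u ^ i * hg
  · simp

/-- If a line with nonzero intercepts is tangent to the curve at both intercepts, then the
coefficients are a torus translate of a solution of the normalized tangency conditions. -/
theorem exists_torus_translate {S : Set (ℤ × ℤ)} [Fintype S] (hS : ∀ k ∈ S, 0 ≤ k.1 ∧ 0 ≤ k.2)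
    {f : MvPolynomial (Fin 2) ℂ} (hf : SuppIn f S) {a b : ℂ} (ha : a ≠ 0) (hb : b ≠ 0)
    (h₁ : 2 ≤ interMult f (-1 / a, 0) (b, -a)) (h₂ : 2 ≤ interMult f (0, -1 / b) (b, -a)) :
    ∃ d : S → ℂ, ∑ k, d k • tangencyVec k = 0 ∧
      ∀ k : S, coeffAt f k = d k * (-a) ^ k.1.1.toNat * (-b) ^ k.1.2.toNat := by
  have e10 := coeff_lineRestrict_eq_zero h₁ (n := 0) (by norm_num)
  have e11 := coeff_lineRestrict_eq_zero h₁ (n := 1) (by norm_num)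
  have e20 := coeff_lineRestrict_eq_zero h₂ (n := 0) (by norm_num)
  have e21 := coeff_lineRestrict_eq_zero h₂ (n := 1) (by norm_num)
  rw [lineRestrict_eq_sum hS hf, Polynomial.finsetSum_coeff] at e10 e11 e20 e21
  simp only [Polynomial.coeff_C_mul] at e10 e11 e20 e21
  simp only [Polynomial.mul_coeff_zero, Polynomial.mul_coeff_one, coeff_one_pow_linear]
    at e10 e11 e20 e21
  simp only [Polynomial.coeff_zero_eq_eval_zero, Polynomial.eval_pow, Polynomial.eval_add,
    Polynomial.eval_mul, Polynomial.eval_C, Polynomial.eval_X, mul_zero, add_zero]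
    at e10 e11 e20 e21
  have hua : -1 / a * a = -1 := by field_simp
  have hvb : -1 / b * b = -1 := by field_simp
  generalize -1 / a = u at *
  generalize -1 / b = v at *
  refine ⟨fun k => coeffAt f k * (u ^ k.1.1.toNat * v ^ k.1.2.toNat), ?_, fun k => ?_⟩
  · ext c
    simp only [Finset.sum_apply, Pi.smul_apply, smul_eq_mul, Pi.zero_apply]
    fin_cases c
    · rw [← e10]
      refine Finset.sum_congr rfl fun k _ => ?_
      obtain ⟨⟨i, j⟩, hk⟩ := k
      obtain ⟨hi, hj⟩ := hS _ hk
      lift i to ℕ using hi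
      lift j to ℕ using hj
      rcases j with _ | j <;> simp [tangencyVec]
      omega
    · rw [← e20]
      refine Finset.sum_congr rfl fun k _ => ?_
      obtain ⟨⟨i, j⟩, hk⟩ := k
      obtain ⟨hi, hj⟩ := hS _ hk
      lift i to ℕ using hi
      lift j to ℕ using hj
      rcases i with _ | i <;> simp [tangencyVec]
      omega
    · rw [← mul_zero (-(u * v)), ← e11, Finset.mul_sum]
      refine Finset.sum_congr rfl fun k _ => ?_
      obtain ⟨⟨i, j⟩, hk⟩ := k
      obtain ⟨hi, hj⟩ := hS _ hk
      lift i to ℕ using hi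
      lift j to ℕ using hj
      have := tangency_term u v (-b) a (by linear_combination -hvb) hua i j
      simp [tangencyVec, -mul_ite]
      linear_combination (-coeffAt f (i, j)) * this
    · rw [← mul_zero (u * v), ← e21, Finset.mul_sum]
      refine Finset.sum_congr rfl fun k _ => ?_
      obtain ⟨⟨i, j⟩, hk⟩ := k
      obtain ⟨hi, hj⟩ := hS _ hk
      lift i to ℕ using hi
      lift j to ℕ using hj
      have := tangency_term v u (-a) b (by linear_combination -hua) hvb j i
      simp [tangencyVec, -mul_ite]
      linear_combination (-coeffAt f (i, j)) * this
  · have hu : (u * -a) = 1 := by linear_combination -hua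
    have hv : (v * -b) = 1 := by linear_combination -hvb
    calc coeffAt f k
        = coeffAt f k * ((u * -a) ^ k.1.1.toNat * (v * -b) ^ k.1.2.toNat) := by simp [hu, hv]
      _ = _ := by rw [mul_pow, mul_pow]; ring

/-- If three lattice points impose independent conditions, there is no axis-to-axis bitangent. -/
theorem genericOn_of_linearIndependent {S : Set (ℤ × ℤ)} [Fintype S]
    (hS : ∀ k ∈ S, 0 ≤ k.1 ∧ 0 ≤ k.2) {κ : Fin 3 → ℤ × ℤ} (hκ : ∀ i, κ i ∈ S)
    (hli : LinearIndependent ℂ fun i => tangencyVec (κ i)) :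
    GenericOn S (fun f => ¬∃ a b : ℂ, a ≠ 0 ∧ b ≠ 0 ∧
      2 ≤ interMult f (-1 / a, 0) (b, -a) ∧ 2 ≤ interMult f (0, -1 / b) (b, -a)) := by
  let Φ := Fintype.linearCombination ℂ (fun k : S => tangencyVec k)
  have hrange : 3 ≤ Module.finrank ℂ Φ.range := by
    have h := finrank_span_eq_card hli
    rw [Fintype.card_fin] at h
    rw [← h, Fintype.range_linearCombination]
    refine Submodule.finrank_mono (Submodule.span_mono ?_)
    rintro _ ⟨i, rfl⟩
    exact ⟨⟨κ i, hκ i⟩, rfl⟩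
  have hrn := Φ.finrank_range_add_finrank_ker
  rw [Module.finrank_pi] at hrn
  obtain ⟨D, hD, hvan⟩ := exists_ne_zero_eval_torus_translate Φ.ker (by omega)
  refine ⟨D, hD, ?_⟩
  rintro f hf hne ⟨a, b, ha, hb, h₁, h₂⟩
  obtain ⟨d, hd, hc⟩ := exists_torus_translate hS hf ha hb h₁ h₂
  refine hne ?_
  simp only [hc]
  exact hvan d (by simpa [Φ, Fintype.linearCombination_apply] using hd) _ _

/-- If a single lattice point contributes to one of the conditions, there is no axis-to-axis
bitangent. -/
theorem genericOn_of_unique {S : Set (ℤ × ℤ)} [Fintype S]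
    (hS : ∀ k ∈ S, 0 ≤ k.1 ∧ 0 ≤ k.2) {k₀ : ℤ × ℤ} (hk₀ : k₀ ∈ S) (c : Fin 4)
    (hne : tangencyVec k₀ c ≠ 0) (h0 : ∀ k ∈ S, k ≠ k₀ → tangencyVec k c = 0) :
    GenericOn S (fun f => ¬∃ a b : ℂ, a ≠ 0 ∧ b ≠ 0 ∧
      2 ≤ interMult f (-1 / a, 0) (b, -a) ∧ 2 ≤ interMult f (0, -1 / b) (b, -a)) := by
  refine ⟨X ⟨k₀, hk₀⟩, X_ne_zero _, ?_⟩
  rintro f hf hcoeff ⟨a, b, ha, hb, h₁, h₂⟩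
  obtain ⟨d, hd, hc⟩ := exists_torus_translate hS hf ha hb h₁ h₂
  have hdc := congrFun hd c
  rw [Finset.sum_apply, Finset.sum_eq_single ⟨k₀, hk₀⟩] at hdc
  · have hd0 : d ⟨k₀, hk₀⟩ = 0 := by simpa [hne] using hdc
    exact hcoeff (by simp [hc ⟨k₀, hk₀⟩, hd0])
  · intro k _ hk
    simp [h0 k k.2 fun h => hk (Subtype.ext h)]
  · simp

theorem latticePts_convexHull_finite (V : Finset (ℤ × ℤ)) :
    (latticePts (convexHull ℝ (rpt '' (V : Set (ℤ × ℤ))))).Finite := by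
  have hb : Bornology.IsBounded (convexHull ℝ (rpt '' (V : Set (ℤ × ℤ)))) :=
    isBounded_convexHull.2 (V.finite_toSet.image _).isBounded
  obtain ⟨r, hr⟩ := hb.exists_norm_le
  refine (Set.finite_Icc ((-⌈r⌉, -⌈r⌉) : ℤ × ℤ) (⌈r⌉, ⌈r⌉)).subset fun k hk => ?_
  have h := (hr _ hk).trans (Int.le_ceil r)
  rw [Prod.norm_def, sup_le_iff] at h
  simp only [rpt, Real.norm_eq_abs, abs_le] at h
  norm_cast at h
  exact ⟨⟨h.1.1, h.2.1⟩, ⟨h.1.2, h.2.2⟩⟩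

/-- The face of a lattice polygon in any direction contains a lattice point. -/
theorem IsLatticePolygon.exists_rpt_mem_face {P : Set (ℝ × ℝ)} (hP : IsLatticePolygon P)
    (γ : ℤ × ℤ) : ∃ k, rpt k ∈ face P γ := by
  obtain ⟨V, hV, rfl⟩ := hP
  obtain ⟨k, hk, hmax⟩ := V.exists_max_image (fun k => γ.1 * k.1 + γ.2 * k.2) hV
  refine ⟨k, subset_convexHull ℝ _ ⟨k, hk, rfl⟩, ?_⟩
  have hlin : IsLinearMap ℝ fun q : ℝ × ℝ => (γ.1 : ℝ) * q.1 + (γ.2 : ℝ) * q.2 :=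
    ⟨fun x y => by simp; ring, fun c x => by simp; ring⟩
  refine convexHull_min ?_ (convex_halfSpace_le hlin _)
  rintro _ ⟨m, hm, rfl⟩
  have := hmax m hm
  change (γ.1 : ℝ) * (m.1 : ℝ) + γ.2 * (m.2 : ℝ) ≤ γ.1 * (k.1 : ℝ) + γ.2 * (k.2 : ℝ)
  exact_mod_cast this

theorem linearIndependent_three {K E : Type*} [Field K] [AddCommGroup E] [Module K E]
    {v : Fin 3 → E} (h : ∀ x y z : K, x • v 0 + y • v 1 + z • v 2 = 0 → x = 0 ∧ y = 0 ∧ z = 0) :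
    LinearIndependent K v := by
  rw [Fintype.linearIndependent_iff]
  intro g hg
  rw [Fin.sum_univ_three] at hg
  obtain ⟨h0, h1, h2⟩ := h _ _ _ hg
  intro i
  fin_cases i <;> assumption

theorem linearIndependent_tangencyVec_horizontal {i i' j : ℤ} (hi : 1 ≤ i) (hi' : 1 ≤ i')
    (hne : i ≠ i') (hj : 1 ≤ j) :
    LinearIndependent ℂ fun n => tangencyVec (![(i, 0), (i', 0), (0, j)] n) := by
  have hi0 : i ≠ 0 := by omega
  have hi0' : i' ≠ 0 := by omega
  have hj0 : j ≠ 0 := by omega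
  refine linearIndependent_three fun x y z h => ?_
  have h0 := congrFun h 0
  have h1 := congrFun h 1
  have h2 := congrFun h 2
  simp [tangencyVec, hi0, hi0', hj0] at h0 h1 h2
  subst h1
  have hsub : (i : ℂ) - i' ≠ 0 := by
    rw [sub_ne_zero]; exact_mod_cast hne
  have hx : x = 0 := by
    apply (mul_eq_zero.1 (_ : x * ((i : ℂ) - i') = 0)).resolve_right hsub
    linear_combination h2 - i' * h0
  exact ⟨hx, by simpa [hx] using h0, rfl⟩

theorem linearIndependent_tangencyVec_vertical {i j j' : ℤ} (hi : 1 ≤ i) (hj : 1 ≤ j)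
    (hj' : 1 ≤ j') (hne : j ≠ j') :
    LinearIndependent ℂ fun n => tangencyVec (![(0, j), (0, j'), (i, 0)] n) := by
  have hi0 : i ≠ 0 := by omega
  have hj0 : j ≠ 0 := by omega
  have hj0' : j' ≠ 0 := by omega
  refine linearIndependent_three fun x y z h => ?_
  have h0 := congrFun h 0
  have h1 := congrFun h 1
  have h2 := congrFun h 3
  simp [tangencyVec, hi0, hj0, hj0'] at h0 h1 h2
  subst h0
  have hsub : (j : ℂ) - j' ≠ 0 := by
    rw [sub_ne_zero]; exact_mod_cast hne
  have hx : x = 0 := by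
    apply (mul_eq_zero.1 (_ : x * ((j : ℂ) - j') = 0)).resolve_right hsub
    linear_combination h2 - j' * h1
  exact ⟨hx, by simpa [hx] using h1, rfl⟩

theorem linearIndependent_tangencyVec_unit_square :
    LinearIndependent ℂ fun n => tangencyVec (![(0, 0), (1, 0), (1, 1)] n) := by
  refine linearIndependent_three fun x y z h => ?_
  have h0 := congrFun h 0
  have h1 := congrFun h 1
  have h2 := congrFun h 2
  have h3 := congrFun h 3
  simp [tangencyVec] at h0 h1 h2 h3
  subst h1
  have hy : y = 0 := by linear_combination h0
  exact ⟨rfl, hy, by linear_combination hy - h2⟩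

/-- A lattice polygon in the quadrant meeting each axis in exactly a unit segment at the origin
is the standard triangle or contains the unit square. -/
theorem one_one_mem_latticePts {P : Set (ℝ × ℝ)} (hP : IsLatticePolygon P)
    (hpos : P ⊆ {p : ℝ × ℝ | 0 ≤ p.1 ∧ 0 ≤ p.2})
    (hdelta : ¬∃ t : ℤ × ℤ, P = rpt t +ᵥ stdTriangle)
    (h00 : (0, 0) ∈ latticePts P) (h10 : (1, 0) ∈ latticePts P) (h01 : (0, 1) ∈ latticePts P)
    (hx : ∀ i : ℤ, (i, 0) ∈ latticePts P → i ≤ 1) (hy : ∀ j : ℤ, (0, j) ∈ latticePts P → j ≤ 1) :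
    (1, 1) ∈ latticePts P := by
  obtain ⟨V, -, rfl⟩ := hP
  have hconv := convex_convexHull ℝ (rpt '' (V : Set (ℤ × ℤ)))
  have hVP := subset_convexHull ℝ (rpt '' (V : Set (ℤ × ℤ)))
  simp only [latticePts, Set.mem_ofPred_eq] at h00 h10 h01 hx hy ⊢
  obtain ⟨⟨k, l⟩, hkl, hk, hl⟩ : ∃ k ∈ V, 1 ≤ k.1 ∧ 1 ≤ k.2 := by
    by_contra! hV
    refine hdelta ⟨0, ?_⟩
    have hz : rpt 0 = 0 := by simp [rpt]
    rw [hz, zero_vadd]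
    apply Set.Subset.antisymm
    · refine convexHull_mono ?_
      rintro _ ⟨⟨k, l⟩, hkl, rfl⟩
      have hmem := hVP ⟨_, hkl, rfl⟩
      obtain ⟨hk, hl⟩ := hpos hmem
      simp only [rpt, Int.cast_nonneg_iff] at hk hl
      have h := hV _ hkl
      simp only at h
      obtain hk0 | hk1 := hk.eq_or_lt
      · subst hk0
        have := hy l hmem
        obtain rfl | rfl : l = 0 ∨ l = 1 := by omega
        all_goals simp [rpt]
      · obtain rfl : l = 0 := by have := h (by omega); omega
        have := hx k hmem
        obtain rfl : k = 1 := by omega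
        simp [rpt]
    · refine convexHull_min ?_ hconv
      rintro _ (rfl | rfl | rfl)
      · simpa [rpt] using h00
      · simpa [rpt] using h10
      · simpa [rpt] using h01
  have hkl := hVP ⟨_, hkl, rfl⟩
  have hk' : (1 : ℝ) ≤ k := by exact_mod_cast hk
  have hl' : (1 : ℝ) ≤ l := by exact_mod_cast hl
  have hs : (0 : ℝ) < k + l - 1 := by linarith
  have h := hconv.sum_mem (t := Finset.univ)
    (w := ![((l : ℝ) - 1) / (k + l - 1), ((k : ℝ) - 1) / (k + l - 1), 1 / (k + l - 1)])
    (z := ![rpt (1, 0), rpt (0, 1), rpt (k, l)]) ?_ ?_ ?_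
  · convert h using 1
    simp [Fin.sum_univ_three, rpt]
    constructor <;> field_simp <;> ring
  · intro i _
    fin_cases i
    · exact div_nonneg (by linarith) hs.le
    · exact div_nonneg (by linarith) hs.le
    · exact div_nonneg zero_le_one hs.le
  · simp [Fin.sum_univ_three]
    field_simp
    ring
  · intro i _
    fin_cases i <;> assumption

theorem rpt_mem_of_segment {P : Set (ℝ × ℝ)} (hP : Convex ℝ P) (h00 : rpt (0, 0) ∈ P) {n : ℤ}
    (hn : 1 ≤ n) {k : ℤ × ℤ} (hk : rpt (n * k.1, n * k.2) ∈ P) : rpt k ∈ P := by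
  have hn' : (1 : ℝ) ≤ n := by exact_mod_cast hn
  have hn0 : (n : ℝ) ≠ 0 := by positivity
  have h := hP h00 hk (a := 1 - 1 / n) (b := 1 / n)
    (by rw [sub_nonneg, div_le_one (by linarith)]; exact hn') (by positivity) (by ring)
  convert h using 1
  simp [rpt, hn0]

theorem no_axis_to_axis_bitangent (P : Set (ℝ × ℝ)) (hP : IsLatticePolygon P)
    (hpos : P ⊆ {p : ℝ × ℝ | 0 ≤ p.1 ∧ 0 ≤ p.2})
    (hline : ¬Collinear ℝ P)
    (hdelta : ¬∃ t : ℤ × ℤ, P = rpt t +ᵥ stdTriangle)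
    (hdown : face P (0, -1) ⊆ {p : ℝ × ℝ | p.2 = 0})
    (hleft : face P (-1, 0) ⊆ {p : ℝ × ℝ | p.1 = 0}) :
    GenericOn (latticePts P) (fun f =>
      ¬∃ a b : ℂ, a ≠ 0 ∧ b ≠ 0 ∧
        2 ≤ interMult f (-1 / a, 0) (b, -a) ∧ 2 ≤ interMult f (0, -1 / b) (b, -a)) := by
  have hS : ∀ k ∈ latticePts P, 0 ≤ k.1 ∧ 0 ≤ k.2 := by
    intro k hk
    simpa [rpt] using hpos hk
  obtain ⟨k₀, hk₀⟩ := hP.exists_rpt_mem_face (0, -1)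
  obtain ⟨m₀, hm₀⟩ := hP.exists_rpt_mem_face (-1, 0)
  obtain ⟨i₀, l⟩ := k₀
  obtain rfl : l = 0 := by simpa [rpt] using hdown hk₀
  obtain ⟨l, j₀⟩ := m₀
  obtain rfl : l = 0 := by simpa [rpt] using hleft hm₀
  have hi₀ : (i₀, 0) ∈ latticePts P := hk₀.1
  have hj₀ : (0, j₀) ∈ latticePts P := hm₀.1
  have hconv : Convex ℝ P := by
    obtain ⟨V, -, rfl⟩ := hP
    exact convex_convexHull ℝ _
  have hfin : (latticePts P).Finite := by
    obtain ⟨V, -, rfl⟩ := hP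
    exact latticePts_convexHull_finite V
  have : Fintype (latticePts P) := hfin.fintype
  by_cases hx : ∃ i, i ≠ i₀ ∧ (i, 0) ∈ latticePts P
  swap
  · push Not at hx
    refine genericOn_of_unique hS hi₀ 0 (by simp [tangencyVec]) ?_
    rintro ⟨i, j⟩ hk hne
    simp only [tangencyVec, Matrix.cons_val_zero, ite_eq_right_iff, one_ne_zero]
    rintro rfl
    exact hx i (fun h => hne (by rw [h])) hk
  by_cases hy : ∃ j, j ≠ j₀ ∧ (0, j) ∈ latticePts P
  swap
  · push Not at hy
    refine genericOn_of_unique hS hj₀ 1 (by simp [tangencyVec]) ?_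
    rintro ⟨i, j⟩ hk hne
    simp only [tangencyVec, Matrix.cons_val_one, Matrix.cons_val_zero, ite_eq_right_iff,
      one_ne_zero]
    rintro rfl
    exact hy j (fun h => hne (by rw [h])) hk
  obtain ⟨i₁, hi, hi₁⟩ := hx
  obtain ⟨j₁, hj, hj₁⟩ := hy
  have hi₀' := (hS _ hi₀).1
  have hi₁' := (hS _ hi₁).1
  have hj₀' := (hS _ hj₀).2
  have hj₁' := (hS _ hj₁).2
  simp only at hi₀' hi₁' hj₀' hj₁'
  obtain ⟨i, hi1, hiP⟩ : ∃ i, 1 ≤ i ∧ (i, 0) ∈ latticePts P := by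
    rcases hi₀'.eq_or_lt with h | h
    · exact ⟨i₁, by omega, hi₁⟩
    · exact ⟨i₀, h, hi₀⟩
  obtain ⟨j, hj1, hjP⟩ : ∃ j, 1 ≤ j ∧ (0, j) ∈ latticePts P := by
    rcases hj₀'.eq_or_lt with h | h
    · exact ⟨j₁, by omega, hj₁⟩
    · exact ⟨j₀, h, hj₀⟩
  by_cases hx : ∃ i', 1 ≤ i' ∧ i ≠ i' ∧ (i', 0) ∈ latticePts P
  · obtain ⟨i', hi1', hne, hiP'⟩ := hx
    refine genericOn_of_linearIndependent hS ?_
      (linearIndependent_tangencyVec_horizontal hi1 hi1' hne hj1)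
    intro n
    fin_cases n <;> assumption
  by_cases hy : ∃ j', 1 ≤ j' ∧ j ≠ j' ∧ (0, j') ∈ latticePts P
  · obtain ⟨j', hj1', hne, hjP'⟩ := hy
    refine genericOn_of_linearIndependent hS ?_
      (linearIndependent_tangencyVec_vertical hi1 hj1 hj1' hne)
    intro n
    fin_cases n <;> assumption
  push Not at hx hy
  have h00 : (0, 0) ∈ latticePts P := by
    rcases hi₀'.eq_or_lt with rfl | h
    · exact hi₀
    · rcases hi₁'.eq_or_lt with rfl | h'
      · exact hi₁
      · by_cases hii : i = i₀
        · exact absurd hi₁ (hx i₁ h' (by omega))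
        · exact absurd hi₀ (hx i₀ h hii)
  have h10 : (1, 0) ∈ latticePts P :=
    rpt_mem_of_segment hconv h00 hi1 (by simpa [latticePts] using hiP)
  have h01 : (0, 1) ∈ latticePts P :=
    rpt_mem_of_segment hconv h00 hj1 (by simpa [latticePts] using hjP)
  obtain rfl : i = 1 := by_contra fun h => hx 1 le_rfl h h10
  obtain rfl : j = 1 := by_contra fun h => hy 1 le_rfl h h01
  have h11 := one_one_mem_latticePts hP hpos hdelta h00 h10 h01
    (fun i hi => by by_contra h; exact hx i (by omega) (by omega) hi)
    (fun j hj => by by_contra h; exact hy j (by omega) (by omega) hj)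
  refine genericOn_of_linearIndependent hS ?_ linearIndependent_tangencyVec_unit_square
  intro n
  fin_cases n <;> assumption

end
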